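/- arXiv:2604.27951 — 11 statements merged into one kernel-verified Lean document; each statement's English description precedes it below -/
import Mathlib

section
/- Assume the recurrence condition: μ₂ < 0 and r₊ < μ₁/μ₂ < r₋. Then G is hermitian: for every t ∈ ℝ, G(−t) equals the complex conjugate of G(t). -/
/-- The coefficient `G` of the Riemann boundary value problem:
`G(t) = −(r₋·i·t − μ₂ − √(μ₂² − 2μ₁·i·t + t²)) / (r₊·i·t − μ₂ − √(μ₂² − 2μ₁·i·t + t²))`
for `t ≠ 0` (principal branch of the complex square root), and
`G(0) = −(μ₁ − r₋μ₂)/(μ₁ − r₊μ₂)`. Here `rp = r₊` and `rm = r₋`. -/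
noncomputable def G (μ₁ μ₂ rp rm : ℝ) (t : ℝ) : ℂ :=
  if t = 0 then ((-((μ₁ - rm * μ₂) / (μ₁ - rp * μ₂)) : ℝ) : ℂ)
  else
    -(((rm : ℂ) * Complex.I * t - (μ₂ : ℂ) -
        ((μ₂ : ℂ) ^ 2 - 2 * μ₁ * Complex.I * t + (t : ℂ) ^ 2) ^ (1 / 2 : ℂ)) /
      ((rp : ℂ) * Complex.I * t - (μ₂ : ℂ) -
        ((μ₂ : ℂ) ^ 2 - 2 * μ₁ * Complex.I * t + (t : ℂ) ^ 2) ^ (1 / 2 : ℂ)))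

/-- Under the recurrence condition (`μ₂ < 0` and `r₊ < μ₁/μ₂ < r₋`),
`G` is hermitian: `G(−t) = conj (G(t))` for all real `t`. -/
theorem G_hermitian (μ₁ μ₂ rp rm : ℝ) (h₂ : μ₂ < 0)
    (hp : rp < μ₁ / μ₂) (hm : μ₁ / μ₂ < rm) :
    ∀ t : ℝ, G μ₁ μ₂ rp rm (-t) = starRingEnd ℂ (G μ₁ μ₂ rp rm t) := by
  intro t
  by_cases ht : t = 0
  · subst ht
    simp only [G, neg_zero, if_true, Complex.conj_ofReal]
  have hnt : -t ≠ 0 := neg_ne_zero.mpr ht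
  set z : ℂ := (μ₂ : ℂ) ^ 2 - 2 * μ₁ * Complex.I * t + (t : ℂ) ^ 2 with hz
  have hre : 0 < z.re := by
    have h : z.re = μ₂ ^ 2 + t ^ 2 := by
      simp [hz, pow_two]
    rw [h]
    have := pow_pos (neg_pos.mpr h₂) 2
    nlinarith [sq_nonneg t]
  have harg : z.arg ≠ Real.pi := by
    intro h
    rw [Complex.arg_eq_pi_iff] at h
    linarith [h.1]
  have h2 : starRingEnd ℂ (2 : ℂ) = 2 := Complex.conj_ofNat 2
  have hconj : (μ₂ : ℂ) ^ 2 - 2 * μ₁ * Complex.I * ((-t : ℝ) : ℂ) + ((-t : ℝ) : ℂ) ^ 2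
      = starRingEnd ℂ z := by
    simp [hz, h2]
  have hs : (starRingEnd ℂ z) ^ (1 / 2 : ℂ) = starRingEnd ℂ (z ^ (1 / 2 : ℂ)) := by
    rw [Complex.conj_cpow _ _ harg]
    simp [h2]
  simp only [G, if_neg ht, if_neg hnt]
  rw [hconj, hs, ← hz]
  simp only [map_neg, map_div₀, map_sub, map_mul, Complex.conj_ofReal, Complex.conj_I]
  push_cast
  ring_nf
end

section
/- Assume the recurrence condition: μ₂ < 0 and r₊ < μ₁/μ₂ < r₋. Then G is continuous at t = 0, i.e. G(t) tends to −(μ₁ − r₋μ₂)/(μ₁ − r₊μ₂) as t → 0, and this limit is a strictly positive real number. -/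
/-- Under the recurrence condition, `G` is continuous at `t = 0`: `G(t)` tends to
`−(μ₁ − r₋μ₂)/(μ₁ − r₊μ₂)` as `t → 0`, and this limit is a strictly positive real. -/
theorem G_continuous_at_zero (μ₁ μ₂ rp rm : ℝ) (h₂ : μ₂ < 0)
    (hp : rp < μ₁ / μ₂) (hm : μ₁ / μ₂ < rm) :
    Filter.Tendsto (G μ₁ μ₂ rp rm) (nhds 0)
      (nhds ((-((μ₁ - rm * μ₂) / (μ₁ - rp * μ₂)) : ℝ) : ℂ)) ∧
    0 < -((μ₁ - rm * μ₂) / (μ₁ - rp * μ₂)) := by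
  have hne : μ₂ ≠ 0 := h₂.ne
  have hp' : μ₁ - rp * μ₂ < 0 := by
    have := (lt_div_iff_of_neg h₂).1 hp
    linarith
  have hm' : 0 < μ₁ - rm * μ₂ := by
    have := (div_lt_iff_of_neg h₂).1 hm
    linarith
  refine ⟨?_, neg_pos.2 (div_neg_of_pos_of_neg hm' hp')⟩
  have hneC : (μ₂ : ℂ) ≠ 0 := by exact_mod_cast hne
  have hpC : (μ₁ : ℂ) - rp * μ₂ ≠ 0 := by exact_mod_cast hp'.ne
  obtain ⟨S, hS⟩ : ∃ S : ℝ → ℂ, S = fun t : ℝ =>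
    ((μ₂ : ℂ) ^ 2 - 2 * μ₁ * Complex.I * t + (t : ℂ) ^ 2) ^ (1 / 2 : ℂ) := ⟨_, rfl⟩
  have hS0 : S 0 = -μ₂ := by
    have h := Complex.sq_cpow_two_inv (x := -(μ₂ : ℂ)) (by simpa using h₂)
    rw [hS]
    simpa using h
  have hS2 : ∀ t : ℝ, S t ^ 2 = (μ₂ : ℂ) ^ 2 - 2 * μ₁ * Complex.I * t + (t : ℂ) ^ 2 := by
    intro t
    have h := Complex.cpow_nat_inv_pow
      ((μ₂ : ℂ) ^ 2 - 2 * μ₁ * Complex.I * t + (t : ℂ) ^ 2) (two_ne_zero)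
    rw [hS]
    simpa using h
  have hSc : ContinuousAt S 0 := by
    rw [hS]
    refine ContinuousAt.cpow (by fun_prop) continuousAt_const ?_
    left
    have : 0 < μ₂ ^ 2 := by positivity
    simpa [← Complex.ofReal_pow] using this
  have hd0 : S 0 - μ₂ ≠ 0 := by
    rw [hS0]
    intro h
    apply hneC
    linear_combination (-1 / 2) * h
  have hev : ∀ᶠ t in nhds (0 : ℝ), S t - μ₂ ≠ 0 :=
    (hSc.sub continuousAt_const).eventually_ne hd0
  have e0 : ∀ r : ℝ, (r : ℂ) * Complex.I - (((0 : ℝ) : ℂ) - 2 * μ₁ * Complex.I) / (S 0 - μ₂)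
      = -Complex.I / μ₂ * (μ₁ - r * μ₂) := by
    intro r
    have h2 : S 0 - μ₂ = -2 * μ₂ := by rw [hS0]; ring
    rw [h2]
    field_simp
    push_cast
    ring
  have hI : -Complex.I / (μ₂ : ℂ) ≠ 0 := div_ne_zero (neg_ne_zero.2 Complex.I_ne_zero) hneC
  have hc : ∀ r : ℝ, ContinuousAt (fun t : ℝ => (r : ℂ) * Complex.I -
      ((t : ℂ) - 2 * μ₁ * Complex.I) / (S t - μ₂)) 0 := fun r =>
    continuousAt_const.sub (ContinuousAt.div (by fun_prop) (hSc.sub continuousAt_const) hd0)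
  have hH := ((hc rm).div (hc rp) (by rw [e0]; exact mul_ne_zero hI hpC)).neg
  have hH' := hH.tendsto
  simp only [Pi.neg_apply, Pi.div_apply] at hH'
  rw [e0, e0, mul_div_mul_left _ _ hI] at hH'
  push_cast
  refine hH'.congr' ?_
  filter_upwards [hev] with t ht
  have key : ∀ r : ℝ, (r : ℂ) * Complex.I * t - μ₂ - S t =
      t * ((r : ℂ) * Complex.I - ((t : ℂ) - 2 * μ₁ * Complex.I) / (S t - μ₂)) := by
    intro r
    field_simp
    linear_combination -hS2 t
  by_cases h0 : t = 0
  · subst h0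
    simp only [G, if_true, Pi.neg_apply, Pi.div_apply]
    rw [e0, e0, mul_div_mul_left _ _ hI]
    push_cast
    rfl
  · have hG : G μ₁ μ₂ rp rm t = -(((rm : ℂ) * Complex.I * t - μ₂ - S t) /
        ((rp : ℂ) * Complex.I * t - μ₂ - S t)) := by
      rw [hS]; simp only [G, if_neg h0]
    rw [hG, key, key, mul_div_mul_left _ _ (by exact_mod_cast h0)]
    rfl
end

section
/- Assume the recurrence condition: μ₂ < 0 and r₊ < μ₁/μ₂ < r₋. Then G(t) tends to −(r₋ + i)/(r₊ + i) as t → +∞, and G(t) tends to −(r₋ − i)/(r₊ − i) as t → −∞. -/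
lemma G_sqrt_aux (μ₁ μ₂ s t : ℝ) (hs : s ^ 2 = 1) (h : 0 < s * t) :
    ((μ₂ : ℂ) ^ 2 - 2 * μ₁ * Complex.I * t + (t : ℂ) ^ 2) ^ (1 / 2 : ℂ) =
      (s : ℂ) * t * ((μ₂ : ℂ) ^ 2 * ((t⁻¹ : ℝ) : ℂ) ^ 2
        - 2 * μ₁ * Complex.I * ((t⁻¹ : ℝ) : ℂ) + 1) ^ (1 / 2 : ℂ) := by
  have ht : t ≠ 0 := by rintro rfl; simp at h
  have htc : (t : ℂ) ≠ 0 := by exact_mod_cast ht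
  have h1 : ((μ₂ : ℂ) ^ 2 - 2 * μ₁ * Complex.I * t + (t : ℂ) ^ 2) =
      (((s * t) ^ 2 : ℝ) : ℂ) * ((μ₂ : ℂ) ^ 2 * ((t⁻¹ : ℝ) : ℂ) ^ 2
        - 2 * μ₁ * Complex.I * ((t⁻¹ : ℝ) : ℂ) + 1) := by
    have : (s * t) ^ 2 = t ^ 2 := by rw [mul_pow, hs, one_mul]
    rw [this]
    push_cast
    field_simp
  have h2 : (((s * t) ^ 2 : ℝ) : ℂ) ^ (1 / 2 : ℂ) = (s : ℂ) * t := by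
    have h3 : (1 / 2 : ℂ) = ((1 / 2 : ℝ) : ℂ) := by push_cast; rfl
    rw [h3, ← Complex.ofReal_cpow (by positivity), ← Real.sqrt_eq_rpow, Real.sqrt_sq h.le]
    push_cast; rfl
  have h0 : (((s * t) ^ 2 : ℝ) : ℂ) ≠ 0 := by
    exact_mod_cast (pow_pos h 2).ne'
  rw [h1, ← h2]
  generalize ((μ₂ : ℂ) ^ 2 * ((t⁻¹ : ℝ) : ℂ) ^ 2
        - 2 * μ₁ * Complex.I * ((t⁻¹ : ℝ) : ℂ) + 1) = z
  by_cases hz : z = 0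
  · subst hz; simp
  · rw [Complex.cpow_def_of_ne_zero (mul_ne_zero h0 hz), Complex.cpow_def_of_ne_zero h0,
      Complex.cpow_def_of_ne_zero hz, Complex.log_ofReal_mul (pow_pos h 2) hz,
      Complex.ofReal_log (pow_pos h 2).le, ← Complex.exp_add, add_mul]

lemma G_tendsto_aux (μ₁ μ₂ rp rm s : ℝ) (hs : s ^ 2 = 1) (l : Filter ℝ)
    (hl : ∀ᶠ t in l, 0 < s * t) (hl' : Filter.Tendsto (fun t : ℝ => t⁻¹) l (nhds 0)) :
    Filter.Tendsto (G μ₁ μ₂ rp rm) l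
      (nhds (-(((rm : ℂ) + s * Complex.I) / ((rp : ℂ) + s * Complex.I)))) := by
  have hs0 : s ≠ 0 := by rintro rfl; norm_num at hs
  let N : ℝ → ℝ → ℂ := fun r u => (r : ℂ) * Complex.I - (μ₂ : ℂ) * (u : ℂ) -
    (s : ℂ) * ((μ₂ : ℂ) ^ 2 * (u : ℂ) ^ 2 - 2 * μ₁ * Complex.I * (u : ℂ) + 1) ^ (1 / 2 : ℂ)
  have hN0 : ∀ r : ℝ, N r 0 = Complex.I * ((r : ℂ) + s * Complex.I) := by
    intro r
    simp only [N]
    simp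
    linear_combination (-(s : ℂ)) * Complex.I_mul_I
  have hd : ((rp : ℂ) + s * Complex.I) ≠ 0 := by
    intro h
    have := congrArg Complex.im h
    simp at this
    exact hs0 this
  have hc : ∀ r : ℝ, ContinuousAt (N r) 0 := by
    intro r
    have h1 : ContinuousAt (fun u : ℝ =>
        ((μ₂ : ℂ) ^ 2 * (u : ℂ) ^ 2 - 2 * μ₁ * Complex.I * (u : ℂ) + 1)) 0 := by
      fun_prop
    have h2 := h1.cpow (continuousAt_const (y := (1 / 2 : ℂ))) (by simp)
    have h3 : ContinuousAt (fun u : ℝ => (r : ℂ) * Complex.I - (μ₂ : ℂ) * (u : ℂ)) 0 := by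
      fun_prop
    exact h3.sub (continuousAt_const.mul h2)
  have hF : ContinuousAt (fun u => -(N rm u / N rp u)) 0 :=
    ((hc rm).div (hc rp) (by rw [hN0]; exact mul_ne_zero Complex.I_ne_zero hd)).neg
  have hT := hF.tendsto.comp hl'
  rw [hN0, hN0, mul_div_mul_left _ _ Complex.I_ne_zero] at hT
  refine hT.congr' ?_
  filter_upwards [hl] with t ht
  have ht0 : t ≠ 0 := by rintro rfl; simp at ht
  have htc : (t : ℂ) ≠ 0 := by exact_mod_cast ht0
  have key : ∀ r : ℝ, (r : ℂ) * Complex.I * t - (μ₂ : ℂ) -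
        ((μ₂ : ℂ) ^ 2 - 2 * μ₁ * Complex.I * t + (t : ℂ) ^ 2) ^ (1 / 2 : ℂ) =
        t * N r t⁻¹ := by
    intro r
    rw [G_sqrt_aux μ₁ μ₂ s t hs ht]
    have h5 : (t : ℂ) * ((t⁻¹ : ℝ) : ℂ) = 1 := by
      push_cast; exact mul_inv_cancel₀ htc
    simp only [N]
    linear_combination (μ₂ : ℂ) * h5
  rw [G, if_neg ht0, key, key, mul_div_mul_left _ _ htc]
  rfl

/-- Under the recurrence condition, `G(t) → −(r₋ + i)/(r₊ + i)` as `t → +∞`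
and `G(t) → −(r₋ − i)/(r₊ − i)` as `t → −∞`. -/
theorem G_limits_at_infinity (μ₁ μ₂ rp rm : ℝ) (h₂ : μ₂ < 0)
    (hp : rp < μ₁ / μ₂) (hm : μ₁ / μ₂ < rm) :
    Filter.Tendsto (G μ₁ μ₂ rp rm) Filter.atTop
      (nhds (-(((rm : ℂ) + Complex.I) / ((rp : ℂ) + Complex.I)))) ∧
    Filter.Tendsto (G μ₁ μ₂ rp rm) Filter.atBot
      (nhds (-(((rm : ℂ) - Complex.I) / ((rp : ℂ) - Complex.I)))) := by
  constructor
  · have := G_tendsto_aux μ₁ μ₂ rp rm 1 (by norm_num) Filter.atTop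
      (by filter_upwards [Filter.eventually_gt_atTop 0] with t ht; linarith)
      tendsto_inv_atTop_zero
    simpa using this
  · have := G_tendsto_aux μ₁ μ₂ rp rm (-1) (by norm_num) Filter.atBot
      (by filter_upwards [Filter.eventually_lt_atBot 0] with t ht; linarith)
      tendsto_inv_atBot_zero
    simpa [← sub_eq_add_neg] using this
end

section
/- Assume the recurrence condition: μ₂ < 0 and r₊ < μ₁/μ₂ < r₋. Then for every t ≠ 0 the denominator r₊·i·t − μ₂ − √(μ₂² − 2μ₁·i·t + t²) is nonzero, and the image G(ℝ) avoids the closed negative real half-line: for every t ≠ 0 the imaginary part of G(t) is nonzero, while G(0) is a strictly positive real number. In particular, G(t) is never a real number ≤ 0. -/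
theorem aux_sqrt (z : ℂ) (hz : z ≠ 0) :
    0 ≤ (z ^ (1 / 2 : ℂ)).re ∧ z ^ (1 / 2 : ℂ) * z ^ (1 / 2 : ℂ) = z := by
  constructor
  · rw [Complex.cpow_def_of_ne_zero hz, Complex.exp_re]
    have h : (Complex.log z * (1 / 2 : ℂ)).im = z.arg / 2 := by
      have : (1 / 2 : ℂ) = ((1 / 2 : ℝ) : ℂ) := by norm_num
      rw [this, Complex.im_mul_ofReal, Complex.log_im]; ring
    rw [h]
    apply mul_nonneg (Real.exp_pos _).le
    apply Real.cos_nonneg_of_neg_pi_div_two_le_of_le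
    · linarith [Complex.neg_pi_lt_arg z]
    · linarith [Complex.arg_le_pi z]
  · rw [← Complex.cpow_add _ _ hz]; norm_num

theorem aux_main (μ₁ μ₂ t : ℝ) (h₂ : μ₂ < 0) (ht : t ≠ 0) :
    0 < μ₂ + (((μ₂ : ℂ) ^ 2 - 2 * μ₁ * Complex.I * t + (t : ℂ) ^ 2) ^ (1 / 2 : ℂ)).re := by
  have hre : ((μ₂ : ℂ) ^ 2 - 2 * μ₁ * Complex.I * t + (t : ℂ) ^ 2).re = μ₂ ^ 2 + t ^ 2 := by
    simp [pow_two]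
  have ht2 : 0 < t ^ 2 := by positivity
  generalize (μ₂ : ℂ) ^ 2 - 2 * μ₁ * Complex.I * t + (t : ℂ) ^ 2 = z at *
  have hz : z ≠ 0 := by
    rintro rfl
    simp at hre
    nlinarith [sq_nonneg μ₂]
  obtain ⟨h1, h3⟩ := aux_sqrt z hz
  generalize z ^ (1 / 2 : ℂ) = s at *
  have := congrArg Complex.re h3
  rw [Complex.mul_re, hre] at this
  nlinarith [mul_self_nonneg s.im]

/-- Under the recurrence condition: for every `t ≠ 0` the denominator
`r₊·i·t − μ₂ − √(μ₂² − 2μ₁·i·t + t²)` is nonzero and `Im (G t) ≠ 0`, while `G 0`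
is a strictly positive real; in particular `G(t)` is never a real number `≤ 0`. -/
theorem G_avoids_negative_reals (μ₁ μ₂ rp rm : ℝ) (h₂ : μ₂ < 0)
    (hp : rp < μ₁ / μ₂) (hm : μ₁ / μ₂ < rm) :
    (∀ t : ℝ, t ≠ 0 →
      (rp : ℂ) * Complex.I * t - (μ₂ : ℂ) -
        ((μ₂ : ℂ) ^ 2 - 2 * μ₁ * Complex.I * t + (t : ℂ) ^ 2) ^ (1 / 2 : ℂ) ≠ 0) ∧
    (∀ t : ℝ, t ≠ 0 → (G μ₁ μ₂ rp rm t).im ≠ 0) ∧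
    ((G μ₁ μ₂ rp rm 0).im = 0 ∧ 0 < (G μ₁ μ₂ rp rm 0).re) ∧
    (∀ t : ℝ, ∀ x : ℝ, x ≤ 0 → G μ₁ μ₂ rp rm t ≠ (x : ℂ)) := by
  have hlt : rp < rm := hp.trans hm
  have hden : ∀ t : ℝ, t ≠ 0 → (rp : ℂ) * Complex.I * t - (μ₂ : ℂ) -
        ((μ₂ : ℂ) ^ 2 - 2 * μ₁ * Complex.I * t + (t : ℂ) ^ 2) ^ (1 / 2 : ℂ) ≠ 0 := by
    intro t ht h0
    have h := aux_main μ₁ μ₂ t h₂ ht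
    generalize ((μ₂ : ℂ) ^ 2 - 2 * μ₁ * Complex.I * t + (t : ℂ) ^ 2) ^ (1 / 2 : ℂ) = s at *
    have := congrArg Complex.re h0
    simp at this
    linarith
  have him : ∀ t : ℝ, t ≠ 0 → (G μ₁ μ₂ rp rm t).im ≠ 0 := by
    intro t ht h0
    have h := aux_main μ₁ μ₂ t h₂ ht
    have hd := hden t ht
    rw [G, if_neg ht] at h0
    generalize ((μ₂ : ℂ) ^ 2 - 2 * μ₁ * Complex.I * t + (t : ℂ) ^ 2) ^ (1 / 2 : ℂ) = s at *
    have hn := Complex.normSq_pos.mpr hd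
    rw [Complex.neg_im, Complex.div_im, ← sub_div, neg_eq_zero, div_eq_zero_iff] at h0
    rcases h0 with h0 | h0
    · simp at h0
      have h4 : (μ₂ + s.re) * (t * (rm - rp)) = 0 := by linear_combination -h0
      exact mul_ne_zero h.ne' (mul_ne_zero ht (sub_pos.mpr hlt).ne') h4
    · exact hn.ne' h0
  have h0 : (G μ₁ μ₂ rp rm 0).im = 0 ∧ 0 < (G μ₁ μ₂ rp rm 0).re := by
    rw [G, if_pos rfl]
    refine ⟨Complex.ofReal_im _, ?_⟩
    rw [Complex.ofReal_re]
    have a := (lt_div_iff_of_neg h₂).mp hp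
    have b := (div_lt_iff_of_neg h₂).mp hm
    have := div_neg_of_pos_of_neg (sub_pos.mpr b) (sub_neg.mpr a)
    linarith
  refine ⟨hden, him, h0, ?_⟩
  intro t x hx h
  by_cases ht : t = 0
  · subst ht
    have := h0.2
    rw [h, Complex.ofReal_re] at this
    linarith
  · apply him t ht
    rw [h, Complex.ofReal_im]
end

section
/- For all real numbers r₊ < r₋, the principal argument of the complex number −(r₋ + i)/(r₊ + i) equals π + arctan(r₊) − arctan(r₋). -/
/-- For all reals `r₊ < r₋`, the principal argument of `−(r₋ + i)/(r₊ + i)`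
equals `π + arctan r₊ − arctan r₋`. Here `rp = r₊` and `rm = r₋`. -/
theorem arg_endpoint (rp rm : ℝ) (h : rp < rm) :
    Complex.arg (-(((rm : ℂ) + Complex.I) / ((rp : ℂ) + Complex.I))) =
      Real.pi + Real.arctan rp - Real.arctan rm := by
  have ha := Real.cos_arctan_pos rp
  have hb := Real.cos_arctan_pos rm
  have hlt := Real.arctan_strictMono h
  have h1 := Real.neg_pi_div_two_lt_arctan rp
  have h2 := Real.arctan_lt_pi_div_two rm
  have hp : rp * Real.cos (Real.arctan rp) = Real.sin (Real.arctan rp) := by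
    conv_lhs => rw [← Real.tan_arctan rp]
    rw [Real.arctan_tan (Real.neg_pi_div_two_lt_arctan _) (Real.arctan_lt_pi_div_two _)]
    exact Real.tan_mul_cos ha.ne'
  have hm : rm * Real.cos (Real.arctan rm) = Real.sin (Real.arctan rm) := by
    conv_lhs => rw [← Real.tan_arctan rm]
    rw [Real.arctan_tan (Real.neg_pi_div_two_lt_arctan _) (Real.arctan_lt_pi_div_two _)]
    exact Real.tan_mul_cos hb.ne'
  generalize Real.arctan rp = a at *
  generalize Real.arctan rm = b at *
  have key : -(((rm : ℂ) + Complex.I) / ((rp : ℂ) + Complex.I)) =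
      ((Real.cos a / Real.cos b : ℝ) : ℂ) *
        (Complex.cos ((Real.pi + a - b : ℝ) : ℂ) +
          Complex.sin ((Real.pi + a - b : ℝ) : ℂ) * Complex.I) := by
    have hne : (rp : ℂ) + Complex.I ≠ 0 := by
      intro h0
      have := congrArg Complex.im h0
      simp at this
    have e : Real.pi + a - b = (a - b) + Real.pi := by ring
    have hs := Real.sin_sq_add_cos_sq a
    rw [← Complex.ofReal_cos, ← Complex.ofReal_sin, e, Real.cos_add_pi, Real.sin_add_pi,
      Real.cos_sub, Real.sin_sub, ← neg_div, div_eq_iff hne]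
    rw [← hp] at hs
    rw [← hp, ← hm]
    apply Complex.ext
    · simp [-Complex.ofReal_div, -Complex.ofReal_cos, -Complex.ofReal_sin, -Complex.ofReal_mul,
        -Complex.ofReal_add, -Complex.ofReal_sub, -Complex.ofReal_neg]
      field_simp
      linear_combination rm * hs
    · simp [-Complex.ofReal_div, -Complex.ofReal_cos, -Complex.ofReal_sin, -Complex.ofReal_mul,
        -Complex.ofReal_add, -Complex.ofReal_sub, -Complex.ofReal_neg]
      field_simp
      linear_combination hs
  rw [key]
  exact Complex.arg_mul_cos_add_sin_mul_I (div_pos ha hb) ⟨by linarith, by linarith⟩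
end

section
/- For every x ∈ (−1, 1) and every y ≤ 0, the double integral of e^{x·u + y·v}·π₀(u, v) over u ∈ ℝ and v ∈ (0, ∞) equals (1/√(1 − x) + 1/√(1 + x)) · 1/(1 + √(1 − x²) − y). -/
open MeasureTheory

/-- The stationary density of the reflected Brownian motion in the upper
half-plane with parameters `(μ₁, μ₂, r₋, r₊) = (0, −1, 1, −1)`:
`π₀(u, v) = (1/√π) · √(√(u² + v²) + v)/√(u² + v²) · exp(−√(u² + v²) − v)`. -/
noncomputable def pi0 (u v : ℝ) : ℝ :=
  (1 / Real.sqrt Real.pi) * Real.sqrt (Real.sqrt (u ^ 2 + v ^ 2) + v) /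
    Real.sqrt (u ^ 2 + v ^ 2) * Real.exp (-Real.sqrt (u ^ 2 + v ^ 2) - v)

namespace LapAux

noncomputable def A (x y θ : ℝ) : ℝ := 1 + Real.sin θ - x * Real.cos θ - y * Real.sin θ

noncomputable def g (x y θ : ℝ) : ℝ :=
  (1 / 2) * Real.sqrt (1 + Real.sin θ) / (A x y θ * Real.sqrt (A x y θ))

lemma A_pos {x y θ : ℝ} (hx : -1 < x) (hx' : x < 1) (hy : y ≤ 0) (hs : 0 ≤ Real.sin θ) :
    0 < A x y θ := by
  unfold A
  have h1 : x * Real.cos θ < 1 := by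
    have hc := Real.abs_cos_le_one θ
    have hxa : |x| < 1 := abs_lt.2 ⟨hx, hx'⟩
    calc x * Real.cos θ ≤ |x * Real.cos θ| := le_abs_self _
      _ = |x| * |Real.cos θ| := abs_mul _ _
      _ ≤ |x| * 1 := by gcongr
      _ < 1 := by linarith
  nlinarith [mul_nonneg (neg_nonneg.2 hy) hs]

lemma radial {a : ℝ} (ha : 0 < a) :
    ∫⁻ r in Set.Ioi (0 : ℝ), ENNReal.ofReal (Real.sqrt r * Real.exp (-(a * r))) =
      ENNReal.ofReal (Real.sqrt Real.pi / 2 / (a * Real.sqrt a)) := by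
  have h := Real.integral_rpow_mul_exp_neg_mul_Ioi (a := 3 / 2) (r := a) (by norm_num) ha
  have hG : Real.Gamma (3 / 2) = Real.sqrt Real.pi / 2 := by
    have : (3 / 2 : ℝ) = 1 / 2 + 1 := by norm_num
    rw [this, Real.Gamma_add_one (by norm_num), Real.Gamma_one_half_eq]; ring
  have hP : (1 / a) ^ (3 / 2 : ℝ) = 1 / (a * Real.sqrt a) := by
    rw [Real.div_rpow zero_le_one ha.le, Real.one_rpow]
    have : (3 / 2 : ℝ) = 1 + 1 / 2 := by norm_num
    rw [this, Real.rpow_add ha, Real.rpow_one, Real.sqrt_eq_rpow]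
  rw [hG, hP] at h
  have h2 : ∫ r in Set.Ioi (0 : ℝ), Real.sqrt r * Real.exp (-(a * r)) =
      Real.sqrt Real.pi / 2 / (a * Real.sqrt a) := by
    rw [show Real.sqrt Real.pi / 2 / (a * Real.sqrt a) =
      1 / (a * Real.sqrt a) * (Real.sqrt Real.pi / 2) by ring, ← h]
    congr 1
    ext r
    rw [Real.sqrt_eq_rpow]; norm_num
  have hpos : 0 < Real.sqrt Real.pi / 2 / (a * Real.sqrt a) := by
    have := Real.pi_pos
    positivity
  rw [← h2, ofReal_integral_eq_lintegral_ofReal]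
  · exact Integrable.of_integral_ne_zero (by rw [h2]; exact hpos.ne')
  · exact Filter.Eventually.of_forall fun r => by positivity

lemma hasDeriv {x y θ : ℝ} (hp : 0 < 1 + Real.sin θ) (hA : 0 < A x y θ)
    (hk : x ^ 2 + y ^ 2 - 2 * y ≠ 0) :
    HasDerivAt (fun θ => (y * Real.cos θ - x * (1 + Real.sin θ)) /
      (Real.sqrt (1 + Real.sin θ) * Real.sqrt (A x y θ)) / (x ^ 2 + y ^ 2 - 2 * y)) (g x y θ) θ := by
  have hs := Real.hasDerivAt_sin θ
  have hc := Real.hasDerivAt_cos θ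
  have h1 := hs.const_add 1
  have hA' : HasDerivAt (A x y) (Real.cos θ - x * (-Real.sin θ) - y * Real.cos θ) θ :=
    (h1.sub (hc.const_mul x)).sub (hs.const_mul y)
  have hN := (hc.const_mul y).sub (h1.const_mul x)
  have hD := (h1.sqrt hp.ne').mul (hA'.sqrt hA.ne')
  have hsp := Real.sqrt_pos.2 hp
  have hsA := Real.sqrt_pos.2 hA
  have := (hN.div hD (mul_pos hsp hsA).ne').div_const (x ^ 2 + y ^ 2 - 2 * y)
  refine this.congr_deriv ?_
  unfold g
  have e1 := Real.sq_sqrt hp.le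
  have e2 := Real.sq_sqrt hA.le
  have hAd : A x y θ = 1 + Real.sin θ - x * Real.cos θ - y * Real.sin θ := rfl
  have e3 := Real.sin_sq_add_cos_sq θ
  simp only [Pi.mul_apply, Pi.sub_apply]
  generalize Real.sqrt (1 + Real.sin θ) = P at *
  generalize Real.sqrt (A x y θ) = Q at *
  generalize A x y θ = a at *
  generalize Real.sin θ = s at *
  generalize Real.cos θ = c at *
  have hs : s = P ^ 2 - 1 := by linarith
  subst e2
  have key : (2 * (y * -s - x * c) * (1 + s) * Q ^ 2 - (y * c - x * (1 + s)) *
     (c * Q ^ 2 + (1 + s) * (c - x * (-s) - y * c))) = (1 + s) ^ 2 * (x ^ 2 + y ^ 2 - 2 * y) := by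
    rw [hAd]
    have : c ^ 2 = 1 - s ^ 2 := by linarith
    have h3 : c ^ 3 = c * (1 - s ^ 2) := by rw [← this]; ring
    ring_nf
    rw [h3, this]
    ring
  generalize x ^ 2 + y ^ 2 - 2 * y = k at *
  rw [hs] at key ⊢
  field_simp
  linear_combination key

lemma hasDeriv0 {θ : ℝ} (hp : 0 < 1 + Real.sin θ) :
    HasDerivAt (fun θ => -(1 / 2) * (Real.cos θ / (1 + Real.sin θ))) (g 0 0 θ) θ := by
  have := ((Real.hasDerivAt_cos θ).div ((Real.hasDerivAt_sin θ).const_add 1) hp.ne').const_mul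
    (-(1 / 2) : ℝ)
  refine this.congr_deriv ?_
  have hA : A 0 0 θ = 1 + Real.sin θ := by simp [A]
  have hsp := Real.sqrt_pos.2 hp
  have e3 := Real.sin_sq_add_cos_sq θ
  rw [g, hA]
  field_simp
  linear_combination e3

lemma angular {x y : ℝ} (hx : -1 < x) (hx' : x < 1) (hy : y ≤ 0) :
    ∫⁻ θ in Set.Ioo 0 Real.pi, ENNReal.ofReal (g x y θ) = ENNReal.ofReal
      ((1 / Real.sqrt (1 - x) + 1 / Real.sqrt (1 + x)) *
        (1 / (1 + Real.sqrt (1 - x ^ 2) - y))) := by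
  have hsin : ∀ θ ∈ Set.Icc 0 Real.pi, 0 ≤ Real.sin θ := fun θ h =>
    Real.sin_nonneg_of_nonneg_of_le_pi h.1 h.2
  have hcont : ContinuousOn (g x y) (Set.Icc 0 Real.pi) := by
    unfold g
    have hc : Continuous (A x y) := by unfold A; fun_prop
    refine ContinuousOn.div (by fun_prop) (by fun_prop) ?_
    intro θ h
    have := A_pos hx hx' hy (hsin θ h)
    positivity
  have hint : IntervalIntegrable (g x y) volume 0 Real.pi :=
    ContinuousOn.intervalIntegrable (by rwa [Set.uIcc_of_le Real.pi_pos.le])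
  rw [← ofReal_integral_eq_lintegral_ofReal]
  · congr 1
    rw [← integral_Ioc_eq_integral_Ioo, ← intervalIntegral.integral_of_le Real.pi_pos.le]
    have ha : 0 < 1 - x := by linarith
    have hb : 0 < 1 + x := by linarith
    by_cases hk : x ^ 2 + y ^ 2 - 2 * y = 0
    · have hx0 : x = 0 := by nlinarith [sq_nonneg x, sq_nonneg y]
      have hy0 : y = 0 := by nlinarith [sq_nonneg x, sq_nonneg y]
      subst hx0 hy0
      rw [intervalIntegral.integral_eq_sub_of_hasDerivAt (fun θ h => hasDeriv0 (by
        rw [Set.uIcc_of_le Real.pi_pos.le] at h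
        linarith [hsin θ h])) hint]
      norm_num
    · rw [intervalIntegral.integral_eq_sub_of_hasDerivAt (fun θ h => hasDeriv (by
        rw [Set.uIcc_of_le Real.pi_pos.le] at h
        linarith [hsin θ h]) (by
        rw [Set.uIcc_of_le Real.pi_pos.le] at h
        exact A_pos hx hx' hy (hsin θ h)) hk) hint]
      simp only [A, Real.sin_pi, Real.cos_pi, Real.sin_zero, Real.cos_zero]
      rw [show 1 - x ^ 2 = (1 - x) * (1 + x) by ring, Real.sqrt_mul ha.le]
      have r1 : (1 : ℝ) + 0 - x * (-1) - y * 0 = 1 + x := by ring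
      have r2 : (1 : ℝ) + 0 - x * 1 - y * 0 = 1 - x := by ring
      rw [r1, r2]
      simp only [add_zero, Real.sqrt_one, one_mul, mul_one]
      have pa := Real.sqrt_pos.2 ha
      have pb := Real.sqrt_pos.2 hb
      have ea := Real.sq_sqrt ha.le
      have eb := Real.sq_sqrt hb.le
      generalize Real.sqrt (1 - x) = a at *
      generalize Real.sqrt (1 + x) = b at *
      have hxe : x = (b ^ 2 - a ^ 2) / 2 := by linarith
      have hne : 1 + a * b - y ≠ 0 := by
        have := mul_pos pa pb
        have : 0 < 1 + a * b - y := by linarith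
        exact this.ne'
      have hk2 : x ^ 2 + y ^ 2 - 2 * y = (1 - a * b - y) * (1 + a * b - y) := by
        have : (a * b) ^ 2 = 1 - x ^ 2 := by rw [mul_pow, ea, eb]; ring
        linear_combination this
      rw [hk2] at hk ⊢
      have hne2 : 1 - a * b - y ≠ 0 := left_ne_zero_of_mul hk
      have hfin : (x - y) * b - (x + y) * a = (a + b) * (1 - a * b - y) := by
        have h2 : a ^ 2 + b ^ 2 = 2 := by linarith
        rw [hxe]
        linear_combination (a + b) / 2 * h2
      have hab : 1 / a + 1 / b = (a + b) / (a * b) := by field_simp; ring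
      rw [hab]
      have e : (y * -1 - x) / b - (y - x) / a = (a + b) * (1 - a * b - y) / (a * b) := by
        rw [← hfin]; field_simp; ring
      rw [← sub_div, e]
      generalize 1 - a * b - y = m at *
      generalize 1 + a * b - y = n at *
      field_simp
  · exact hcont.integrableOn_Icc.mono_set Set.Ioo_subset_Icc_self
  · filter_upwards [ae_restrict_mem measurableSet_Ioo] with θ h
    have := A_pos hx hx' hy (hsin θ (Set.Ioo_subset_Icc_self h))
    simp only [g, Pi.zero_apply]
    positivity

noncomputable def F (x y : ℝ) (p : ℝ × ℝ) : ℝ := Real.exp (x * p.1 + y * p.2) * pi0 p.1 p.2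

lemma F_nonneg (x y : ℝ) (p : ℝ × ℝ) : 0 ≤ F x y p := by
  unfold F pi0; positivity

lemma F_meas (x y : ℝ) : Measurable (F x y) := by
  unfold F pi0; fun_prop

lemma F_polar (x y : ℝ) {r θ : ℝ} (hr : 0 < r) :
    r * F x y (r * Real.cos θ, r * Real.sin θ) =
      1 / Real.sqrt Real.pi * Real.sqrt (1 + Real.sin θ) *
        (Real.sqrt r * Real.exp (-(A x y θ * r))) := by
  have h : Real.sqrt ((r * Real.cos θ) ^ 2 + (r * Real.sin θ) ^ 2) = r := by
    rw [show (r * Real.cos θ) ^ 2 + (r * Real.sin θ) ^ 2 = r ^ 2 by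
      linear_combination r ^ 2 * Real.sin_sq_add_cos_sq θ]
    exact Real.sqrt_sq hr.le
  simp only [F, pi0, h]
  rw [show r + r * Real.sin θ = r * (1 + Real.sin θ) by ring, Real.sqrt_mul hr.le]
  have e : Real.exp (-(A x y θ * r)) = Real.exp (x * (r * Real.cos θ) + y * (r * Real.sin θ)) *
      Real.exp (-r - r * Real.sin θ) := by
    rw [← Real.exp_add]; congr 1; unfold A; ring
  rw [e]
  field_simp

lemma total {x y : ℝ} (hx : -1 < x) (hx' : x < 1) (hy : y ≤ 0) :
    ∫⁻ p in Set.univ ×ˢ Set.Ioi (0 : ℝ), ENNReal.ofReal (F x y p) = ENNReal.ofReal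
      ((1 / Real.sqrt (1 - x) + 1 / Real.sqrt (1 + x)) *
        (1 / (1 + Real.sqrt (1 - x ^ 2) - y))) := by
  have hS : MeasurableSet (Set.univ ×ˢ Set.Ioi (0 : ℝ) : Set (ℝ × ℝ)) :=
    MeasurableSet.univ.prod measurableSet_Ioi
  have hm : Measurable (Set.indicator (Set.univ ×ˢ Set.Ioi (0 : ℝ))
      (fun p => ENNReal.ofReal (F x y p))) :=
    ((F_meas x y).ennreal_ofReal).indicator hS
  rw [← lintegral_indicator hS, ← lintegral_comp_polarCoord_symm, polarCoord_target,
    Measure.volume_eq_prod, ← Measure.prod_restrict, lintegral_prod_symm]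
  swap
  · refine Measurable.aemeasurable ?_
    have : Measurable (polarCoord.symm : ℝ × ℝ → ℝ × ℝ) := by
      have : (polarCoord.symm : ℝ × ℝ → ℝ × ℝ) =
        fun p => (p.1 * Real.cos p.2, p.1 * Real.sin p.2) := by
        ext p <;> simp
      rw [this]; fun_prop
    exact (by fun_prop : Measurable fun p : ℝ × ℝ => ENNReal.ofReal p.1).smul (hm.comp this)
  rw [← angular hx hx' hy]
  rw [← lintegral_indicator measurableSet_Ioo, ← lintegral_indicator measurableSet_Ioo]
  congr 1
  ext θ
  by_cases h : θ ∈ Set.Ioo 0 Real.pi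
  · have h' : θ ∈ Set.Ioo (-Real.pi) Real.pi := ⟨by linarith [h.1, Real.pi_pos], h.2⟩
    rw [Set.indicator_of_mem h, Set.indicator_of_mem h']
    have hs := Real.sin_pos_of_mem_Ioo h
    have hA := A_pos hx hx' hy hs.le
    have : ∀ r ∈ Set.Ioi (0 : ℝ), ENNReal.ofReal (r, θ).1 •
        Set.indicator (Set.univ ×ˢ Set.Ioi (0 : ℝ))
          (fun p => ENNReal.ofReal (F x y p)) (polarCoord.symm (r, θ)) =
        ENNReal.ofReal (1 / Real.sqrt Real.pi * Real.sqrt (1 + Real.sin θ)) *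
        ENNReal.ofReal (Real.sqrt r * Real.exp (-(A x y θ * r))) := by
      intro r hr
      have hr : 0 < r := hr
      rw [polarCoord_symm_apply, Set.indicator_of_mem (by simpa using mul_pos hr hs), smul_eq_mul,
        ← ENNReal.ofReal_mul hr.le, ← ENNReal.ofReal_mul (by positivity)]
      congr 1
      exact F_polar x y hr
    rw [setLIntegral_congr_fun measurableSet_Ioi this, lintegral_const_mul _ (by fun_prop),
      radial hA, ← ENNReal.ofReal_mul (by positivity)]
    congr 1
    have := Real.sqrt_pos.2 Real.pi_pos
    unfold g
    field_simp
  · rw [Set.indicator_of_notMem h]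
    by_cases h' : θ ∈ Set.Ioo (-Real.pi) Real.pi
    · rw [Set.indicator_of_mem h']
      have hθ : θ ≤ 0 := by
        by_contra hc
        exact h ⟨not_le.1 hc, h'.2⟩
      have hs : Real.sin θ ≤ 0 := Real.sin_nonpos_of_nonpos_of_neg_pi_le hθ h'.1.le
      rw [setLIntegral_congr_fun (g := fun _ => 0) measurableSet_Ioi]
      · simp
      · intro r hr
        have hr : 0 < r := hr
        simp only
        rw [polarCoord_symm_apply, Set.indicator_of_notMem, smul_zero]
        simpa using mul_nonpos_of_nonneg_of_nonpos hr.le hs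
    · rw [Set.indicator_of_notMem h']

end LapAux

/-- For `x ∈ (−1, 1)` and `y ≤ 0`, the bivariate Laplace transform of `π₀` over
the upper half-plane equals `(1/√(1−x) + 1/√(1+x)) · 1/(1 + √(1−x²) − y)`. -/
theorem laplace_transform_pi0 (x y : ℝ) (hx : -1 < x) (hx' : x < 1) (hy : y ≤ 0) :
    ∫ u : ℝ, ∫ v in Set.Ioi (0 : ℝ), Real.exp (x * u + y * v) * pi0 u v =
      (1 / Real.sqrt (1 - x) + 1 / Real.sqrt (1 + x)) *
        (1 / (1 + Real.sqrt (1 - x ^ 2) - y)) := by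
  have ht := LapAux.total hx hx' hy
  rw [Measure.volume_eq_prod, ← Measure.prod_restrict, Measure.restrict_univ] at ht
  have hi : Integrable (LapAux.F x y) ((volume : Measure ℝ).prod (volume.restrict (Set.Ioi 0))) := by
    refine ⟨(LapAux.F_meas x y).aestronglyMeasurable, ?_⟩
    rw [hasFiniteIntegral_iff_ofReal (Filter.Eventually.of_forall (LapAux.F_nonneg x y)), ht]
    exact ENNReal.ofReal_lt_top
  have h := integral_prod _ hi
  rw [integral_eq_lintegral_of_nonneg_ae (Filter.Eventually.of_forall (LapAux.F_nonneg x y))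
    (LapAux.F_meas x y).aestronglyMeasurable, ht, ENNReal.toReal_ofReal] at h
  · exact h.symm
  · have : 0 ≤ 1 + Real.sqrt (1 - x ^ 2) - y := by
      have := Real.sqrt_nonneg (1 - x ^ 2)
      linarith
    positivity
end

section
/- For every v ≥ 0, the integral of π₀(u, v) over u ∈ ℝ equals 2·e^{−2v}. -/
open MeasureTheory

lemma pi0_aux_r (v s : ℝ) (hv : 0 ≤ v) :
    Real.sqrt ((s * Real.sqrt (s ^ 2 + 2 * v)) ^ 2 + v ^ 2) = s ^ 2 + v := by
  rw [mul_pow, Real.sq_sqrt (by positivity)]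
  rw [show s ^ 2 * (s ^ 2 + 2 * v) + v ^ 2 = (s ^ 2 + v) ^ 2 by ring]
  exact Real.sqrt_sq (by positivity)

lemma pi0_aux_image (v : ℝ) (hv : 0 ≤ v) :
    (fun s : ℝ => s * Real.sqrt (s ^ 2 + 2 * v)) '' Set.Ioi 0 = Set.Ioi 0 := by
  ext u
  simp only [Set.mem_image, Set.mem_Ioi]
  constructor
  · rintro ⟨s, hs, rfl⟩
    positivity
  · intro hu
    have h1 : v < Real.sqrt (u ^ 2 + v ^ 2) := by
      apply Real.lt_sqrt_of_sq_lt
      have : 0 < u ^ 2 := by positivity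
      linarith
    have h2 : Real.sqrt (u ^ 2 + v ^ 2) ^ 2 = u ^ 2 + v ^ 2 := Real.sq_sqrt (by positivity)
    refine ⟨Real.sqrt (Real.sqrt (u ^ 2 + v ^ 2) - v), Real.sqrt_pos.2 (by linarith), ?_⟩
    rw [Real.sq_sqrt (by linarith), ← Real.sqrt_mul (by linarith)]
    rw [show (Real.sqrt (u ^ 2 + v ^ 2) - v) * (Real.sqrt (u ^ 2 + v ^ 2) - v + 2 * v) = u ^ 2 by
      linear_combination h2]
    exact Real.sqrt_sq hu.le

lemma pi0_aux_deriv (v s : ℝ) (hv : 0 ≤ v) (hs : 0 < s) :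
    HasDerivAt (fun s : ℝ => s * Real.sqrt (s ^ 2 + 2 * v))
      (2 * (s ^ 2 + v) / Real.sqrt (s ^ 2 + 2 * v)) s := by
  have hp : 0 < s ^ 2 + 2 * v := by positivity
  have h := (hasDerivAt_id s).mul ((((hasDerivAt_id s).pow 2).add_const (2 * v)).sqrt hp.ne')
  refine h.congr_deriv ?_
  have hq : Real.sqrt (s ^ 2 + 2 * v) ≠ 0 := (Real.sqrt_pos.2 hp).ne'
  have h2 : Real.sqrt (s ^ 2 + 2 * v) ^ 2 = s ^ 2 + 2 * v := Real.sq_sqrt hp.le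
  simp
  field_simp
  rw [h2]
  ring

/-- For every `v ≥ 0`, the integral of `π₀(·, v)` over `ℝ` equals `2 e^{−2v}`:
the second marginal is the exponential distribution with parameter `2`. -/
theorem pi0_first_marginal (v : ℝ) (hv : 0 ≤ v) :
    ∫ u : ℝ, pi0 u v = 2 * Real.exp (-2 * v) := by
  have habs : ∀ u : ℝ, pi0 u v = pi0 |u| v := fun u => by simp [pi0]
  have hinj : Set.InjOn (fun s : ℝ => s * Real.sqrt (s ^ 2 + 2 * v)) (Set.Ioi 0) := by
    intro a ha b hb hab
    simp only [Set.mem_Ioi] at ha hb hab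
    have h1 := pi0_aux_r v a hv
    rw [hab, pi0_aux_r v b hv] at h1
    nlinarith
  have hsub := integral_image_eq_integral_abs_deriv_smul measurableSet_Ioi
    (fun s hs => (pi0_aux_deriv v s hv hs).hasDerivWithinAt) hinj (fun u => pi0 u v)
  rw [pi0_aux_image v hv] at hsub
  have hcongr : ∀ s ∈ Set.Ioi (0 : ℝ), |2 * (s ^ 2 + v) / Real.sqrt (s ^ 2 + 2 * v)| •
      pi0 (s * Real.sqrt (s ^ 2 + 2 * v)) v =
      (2 / Real.sqrt Real.pi * Real.exp (-2 * v)) * Real.exp (-1 * s ^ 2) := by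
    intro s hs
    have hs : 0 < s := hs
    have hp : 0 < s ^ 2 + 2 * v := by positivity
    have hq : 0 < Real.sqrt (s ^ 2 + 2 * v) := Real.sqrt_pos.2 hp
    have hr : 0 < s ^ 2 + v := by positivity
    have hpi : 0 < Real.sqrt Real.pi := Real.sqrt_pos.2 Real.pi_pos
    rw [abs_of_pos (by positivity), pi0, pi0_aux_r v s hv, smul_eq_mul,
      show s ^ 2 + v + v = s ^ 2 + 2 * v by ring, mul_assoc (2 / _), ← Real.exp_add,
      show -(s ^ 2 + v) - v = -2 * v + -1 * s ^ 2 by ring]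
    field_simp
  rw [setIntegral_congr_fun measurableSet_Ioi hcongr, integral_const_mul,
    integral_gaussian_Ioi] at hsub
  rw [integral_congr_ae (Filter.Eventually.of_forall habs)]
  rw [integral_comp_abs (f := fun u => pi0 u v), hsub]
  have hpi : 0 < Real.sqrt Real.pi := Real.sqrt_pos.2 Real.pi_pos
  rw [div_one]
  field_simp
end

section
/- The function π₀ is a probability density on the upper half-plane: the double integral of π₀(u, v) over u ∈ ℝ and v ∈ (0, ∞) equals 1. -/
open MeasureTheory

noncomputable def parMap (p : ℝ × ℝ) : ℝ × ℝ := (p.1 * p.2, p.1 * (1 - p.2 ^ 2) / 2)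

noncomputable def parDeriv (p : ℝ × ℝ) : ℝ × ℝ →L[ℝ] ℝ × ℝ :=
  (Matrix.toLin (Module.Basis.finTwoProd ℝ) (Module.Basis.finTwoProd ℝ)
    !![p.2, p.1; (1 - p.2 ^ 2) / 2, -(p.1 * p.2)]).toContinuousLinearMap

theorem parDeriv_det (p : ℝ × ℝ) : (parDeriv p).det = -(p.1 * (1 + p.2 ^ 2) / 2) := by
  simp only [parDeriv, LinearMap.det_toContinuousLinearMap, LinearMap.det_toLin,
    Matrix.det_fin_two_of]
  ring

theorem parMap_hasFDerivAt (p : ℝ × ℝ) : HasFDerivAt parMap (parDeriv p) p := by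
  have h1 : HasFDerivAt (fun q : ℝ × ℝ => q.1) (ContinuousLinearMap.fst ℝ ℝ ℝ) p := hasFDerivAt_fst
  have h2 : HasFDerivAt (fun q : ℝ × ℝ => q.2) (ContinuousLinearMap.snd ℝ ℝ ℝ) p := hasFDerivAt_snd
  have h3 := (h1.mul h2).prodMk (((h1.mul ((h2.mul h2).const_sub 1))).mul_const (1 / 2 : ℝ))
  have h4 := h3.congr_of_eventuallyEq (f₁ := parMap) (Filter.Eventually.of_forall fun q => by
    simp only [parMap, Prod.mk.injEq, Pi.mul_apply, true_and]
    ring)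
  refine h4.congr_fderiv ?_
  rw [parDeriv, Matrix.toLin_finTwoProd_toContinuousLinearMap]
  ext <;> simp <;> ring

theorem par_r (w t : ℝ) (hw : 0 < w) :
    Real.sqrt ((w * t) ^ 2 + (w * (1 - t ^ 2) / 2) ^ 2) = w * (1 + t ^ 2) / 2 := by
  rw [Real.sqrt_eq_iff_mul_self_eq (by positivity) (by positivity)]
  ring

theorem parMap_injOn : Set.InjOn parMap (Set.Ioi 0 ×ˢ Set.Ioo (-1) 1) := by
  rintro ⟨w, t⟩ ⟨hw, -⟩ ⟨w', t'⟩ ⟨hw', -⟩ h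
  simp only [parMap, Prod.mk.injEq, Set.mem_Ioi] at h hw hw'
  obtain ⟨h1, h2⟩ := h
  have a := par_r w t hw
  have b := par_r w' t' hw'
  rw [h1, h2, b] at a
  have hww : w = w' := by linarith
  subst hww
  simp only [Prod.mk.injEq, true_and]
  exact mul_left_cancel₀ hw.ne' h1

theorem parMap_image :
    parMap '' (Set.Ioi 0 ×ˢ Set.Ioo (-1) 1) = Set.univ ×ˢ Set.Ioi 0 := by
  ext ⟨u, v⟩
  simp only [Set.mem_image, Set.mem_prod, Set.mem_univ, true_and, Set.mem_Ioi, Set.mem_Ioo,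
    Prod.exists]
  constructor
  · rintro ⟨w, t, ⟨hw, h1, h2⟩, h⟩
    simp only [parMap, Prod.mk.injEq] at h
    rw [← h.2]
    have : 0 < 1 - t ^ 2 := by nlinarith
    positivity
  · intro hv
    have hr := Real.sq_sqrt (show 0 ≤ u ^ 2 + v ^ 2 by positivity)
    have hr0 := Real.sqrt_nonneg (u ^ 2 + v ^ 2)
    set r := Real.sqrt (u ^ 2 + v ^ 2)
    have hw : 0 < r + v := by linarith
    have hu : |u| < r + v := by
      have : |u| ≤ r := Real.abs_le_sqrt (by nlinarith)
      linarith
    rw [abs_lt] at hu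
    refine ⟨r + v, u / (r + v), ⟨hw, ?_, ?_⟩, ?_⟩
    · rw [lt_div_iff₀ hw]; linarith
    · rw [div_lt_iff₀ hw]; linarith
    · simp only [parMap, Prod.mk.injEq]
      constructor
      · field_simp
      · field_simp
        nlinarith

theorem par_integrand (p : ℝ × ℝ) (hp : p ∈ Set.Ioi (0 : ℝ) ×ˢ Set.Ioo (-1 : ℝ) 1) :
    |(parDeriv p).det| • (Function.uncurry pi0) (parMap p) =
      (1 / Real.sqrt Real.pi * (Real.exp (-p.1) * p.1 ^ ((3 / 2 : ℝ) - 1))) * 1 := by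
  obtain ⟨w, t⟩ := p
  have hw : 0 < w := hp.1
  rw [parDeriv_det]
  simp only [parMap, Function.uncurry, pi0, par_r w t hw, smul_eq_mul]
  have hr : 0 < w * (1 + t ^ 2) / 2 := by positivity
  rw [abs_neg, abs_of_pos hr]
  have e1 : w * (1 + t ^ 2) / 2 + w * (1 - t ^ 2) / 2 = w := by ring
  have e2 : -(w * (1 + t ^ 2) / 2) - w * (1 - t ^ 2) / 2 = -w := by ring
  rw [e1, e2, show ((3 / 2 : ℝ) - 1) = 1 / 2 by norm_num, ← Real.sqrt_eq_rpow]
  have := hr.ne'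
  field_simp

theorem par_measurable : MeasurableSet (Set.Ioi (0 : ℝ) ×ˢ Set.Ioo (-1 : ℝ) 1) :=
  measurableSet_Ioi.prod measurableSet_Ioo

theorem pi0_integrableOn :
    IntegrableOn (Function.uncurry pi0) (Set.univ ×ˢ Set.Ioi 0) (volume.prod volume) := by
  rw [← parMap_image, ← Measure.volume_eq_prod,
    integrableOn_image_iff_integrableOn_abs_det_fderiv_smul volume par_measurable
      (fun p _ => (parMap_hasFDerivAt p).hasFDerivWithinAt) parMap_injOn,
    integrableOn_congr_fun par_integrand par_measurable, IntegrableOn, Measure.volume_eq_prod,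
    ← Measure.prod_restrict]
  refine Integrable.mul_prod (f := fun w : ℝ => 1 / Real.sqrt Real.pi *
    (Real.exp (-w) * w ^ ((3 / 2 : ℝ) - 1))) (g := fun _ : ℝ => (1 : ℝ)) ?_ ?_
  · exact (Real.GammaIntegral_convergent (by norm_num)).const_mul _
  · exact integrableOn_const (by simp)

theorem pi0_setIntegral :
    ∫ p in Set.univ ×ˢ Set.Ioi 0, Function.uncurry pi0 p ∂(volume.prod volume) = 1 := by
  rw [← parMap_image, ← Measure.volume_eq_prod,
    integral_image_eq_integral_abs_det_fderiv_smul volume par_measurable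
      (fun p _ => (parMap_hasFDerivAt p).hasFDerivWithinAt) parMap_injOn,
    setIntegral_congr_fun par_measurable par_integrand, Measure.volume_eq_prod,
    setIntegral_prod_mul (fun w : ℝ => 1 / Real.sqrt Real.pi *
    (Real.exp (-w) * w ^ ((3 / 2 : ℝ) - 1))) (fun _ : ℝ => (1 : ℝ)),
    integral_const_mul, ← Real.Gamma_eq_integral (by norm_num),
    show (3 / 2 : ℝ) = 1 / 2 + 1 by norm_num, Real.Gamma_add_one (by norm_num),
    Real.Gamma_one_half_eq]
  have : Real.sqrt Real.pi ≠ 0 := (Real.sqrt_pos.2 Real.pi_pos).ne'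
  simp
  field_simp
  norm_num

/-- `π₀` is a probability density on the upper half-plane: the double integral
of `π₀(u, v)` over `u ∈ ℝ` and `v ∈ (0, ∞)` equals `1`. -/
theorem pi0_is_probability_density :
    ∫ u : ℝ, ∫ v in Set.Ioi (0 : ℝ), pi0 u v = 1 := by
  have h := setIntegral_prod _ pi0_integrableOn
  rw [pi0_setIntegral, setIntegral_univ] at h
  exact h.symm
end

section
/- At every point (u, v) with v > 0, the function π₀ satisfies the stationary Fokker–Planck equation (1/2)·(∂²π₀/∂u² + ∂²π₀/∂v²)(u, v) + (∂π₀/∂v)(u, v) = 0, the partial derivatives existing at each such point. -/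
open MeasureTheory

lemma r_pos (u v : ℝ) (hv : 0 < v) : 0 < Real.sqrt (u ^ 2 + v ^ 2) := by
  apply Real.sqrt_pos.mpr; positivity

lemma r_u (u v : ℝ) (hv : 0 < v) :
    HasDerivAt (fun x => Real.sqrt (x ^ 2 + v ^ 2)) (u / Real.sqrt (u ^ 2 + v ^ 2)) u := by
  have h : HasDerivAt (fun x : ℝ => x ^ 2 + v ^ 2) (2 * u) u := by
    simpa using (hasDerivAt_pow 2 u).add_const (v ^ 2)
  have h2 := h.sqrt (by positivity)
  have := r_pos u v hv
  convert h2 using 1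
  field_simp

lemma r_v (u v : ℝ) (hv : 0 < v) :
    HasDerivAt (fun x => Real.sqrt (u ^ 2 + x ^ 2)) (v / Real.sqrt (u ^ 2 + v ^ 2)) v := by
  have h : HasDerivAt (fun x : ℝ => u ^ 2 + x ^ 2) (2 * v) v := by
    simpa using (hasDerivAt_pow 2 v).const_add (u ^ 2)
  have h2 := h.sqrt (by positivity)
  have := r_pos u v hv
  convert h2 using 1
  field_simp

/-- Logarithmic derivative in `u`. -/
noncomputable def FF (u v : ℝ) : ℝ :=
  u / (2 * Real.sqrt (u ^ 2 + v ^ 2) * (Real.sqrt (u ^ 2 + v ^ 2) + v))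
    - u / Real.sqrt (u ^ 2 + v ^ 2) ^ 2 - u / Real.sqrt (u ^ 2 + v ^ 2)

/-- Logarithmic derivative in `v`. -/
noncomputable def GG (u v : ℝ) : ℝ :=
  1 / (2 * Real.sqrt (u ^ 2 + v ^ 2))
    - v / Real.sqrt (u ^ 2 + v ^ 2) ^ 2 - v / Real.sqrt (u ^ 2 + v ^ 2) - 1

lemma pi_u (u v : ℝ) (hv : 0 < v) :
    HasDerivAt (fun x => pi0 x v) (pi0 u v * FF u v) u := by
  have hr := r_pos u v hv
  have h1 := r_u u v hv
  have hs := (h1.add_const v).sqrt (by positivity)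
  have h := ((hs.const_mul (1 / Real.sqrt Real.pi)).fun_div h1 hr.ne').fun_mul
    ((h1.fun_neg.sub_const v).exp)
  refine h.congr_deriv ?_
  unfold pi0 FF
  set r := Real.sqrt (u ^ 2 + v ^ 2)
  have hp : 0 < Real.sqrt (r + v) := Real.sqrt_pos.mpr (by positivity)
  have hq : r + v = Real.sqrt (r + v) ^ 2 := (Real.sq_sqrt (by positivity)).symm
  generalize Real.exp (-r - v) = e
  generalize Real.sqrt (r + v) = s at *
  have hpi : 0 < Real.sqrt Real.pi := Real.sqrt_pos.mpr Real.pi_pos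
  rw [hq]
  field_simp
  ring

lemma pi_v (u v : ℝ) (hv : 0 < v) :
    HasDerivAt (fun x => pi0 u x) (pi0 u v * GG u v) v := by
  have hr := r_pos u v hv
  have h1 := r_v u v hv
  have hs := (h1.fun_add (hasDerivAt_id' v)).sqrt (by positivity)
  have h := ((hs.const_mul (1 / Real.sqrt Real.pi)).fun_div h1 hr.ne').fun_mul
    ((h1.fun_neg.fun_sub (hasDerivAt_id' v)).exp)
  refine h.congr_deriv ?_
  unfold pi0 GG
  set r := Real.sqrt (u ^ 2 + v ^ 2)
  have hp : 0 < Real.sqrt (r + v) := Real.sqrt_pos.mpr (by positivity)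
  have hq : r + v = Real.sqrt (r + v) ^ 2 := (Real.sq_sqrt (by positivity)).symm
  generalize Real.exp (-r - v) = e
  generalize Real.sqrt (r + v) = s at *
  have hpi : 0 < Real.sqrt Real.pi := Real.sqrt_pos.mpr Real.pi_pos
  have hv' : v = s ^ 2 - r := by linarith
  clear_value r
  subst hv'
  field_simp
  ring

lemma FF_u (u v : ℝ) (hv : 0 < v) : ∃ F', HasDerivAt (fun x => FF x v) F' u ∧
    ∃ G', HasDerivAt (fun x => GG u x) G' v ∧
    FF u v ^ 2 + F' + GG u v ^ 2 + G' + 2 * GG u v = 0 := by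
  have hr := r_pos u v hv
  have h1 := r_u u v hv
  have h2 := r_v u v hv
  have i1 := hasDerivAt_id' u
  have i2 := hasDerivAt_id' v
  refine ⟨_, ((i1.fun_div ((h1.const_mul 2).fun_mul (h1.add_const v)) (by positivity)).fun_sub
    (i1.fun_div (h1.fun_pow 2) (by positivity))).fun_sub (i1.fun_div h1 hr.ne'), _,
    ((((hasDerivAt_const v (1:ℝ)).fun_div (h2.const_mul 2) (by positivity)).fun_sub
    (i2.fun_div (h2.fun_pow 2) (by positivity))).fun_sub (i2.fun_div h2 hr.ne')).sub_const 1, ?_⟩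
  unfold FF GG
  have hq : Real.sqrt (u ^ 2 + v ^ 2) ^ 2 = u ^ 2 + v ^ 2 := Real.sq_sqrt (by positivity)
  generalize Real.sqrt (u ^ 2 + v ^ 2) = r at *
  have hu : u ^ 2 = r ^ 2 - v ^ 2 := by linarith
  have hu4 : u ^ 4 = (r ^ 2 - v ^ 2) ^ 2 := by rw [← hu]; ring
  have hrv : 0 < r + v := by positivity
  field_simp
  norm_num
  ring_nf
  simp only [hu, hu4]
  ring

/-- At every point `(u, v)` with `v > 0`, the density `π₀` satisfies the
stationary Fokker–Planck equation
`(1/2)(∂²π₀/∂u² + ∂²π₀/∂v²)(u,v) + (∂π₀/∂v)(u,v) = 0`,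
the partial derivatives existing at each such point. -/
theorem pi0_fokker_planck (u v : ℝ) (hv : 0 < v) :
    DifferentiableAt ℝ (fun u' => pi0 u' v) u ∧
    DifferentiableAt ℝ (deriv fun u' => pi0 u' v) u ∧
    DifferentiableAt ℝ (fun v' => pi0 u v') v ∧
    DifferentiableAt ℝ (deriv fun v' => pi0 u v') v ∧
    (1 / 2) * (deriv (deriv fun u' => pi0 u' v) u +
        deriv (deriv fun v' => pi0 u v') v) +
      deriv (fun v' => pi0 u v') v = 0 := by
  have eu : (deriv fun u' => pi0 u' v) = fun x => pi0 x v * FF x v :=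
    funext fun x => (pi_u x v hv).deriv
  have ev : (deriv fun v' => pi0 u v') =ᶠ[nhds v] fun x => pi0 u x * GG u x := by
    filter_upwards [lt_mem_nhds hv] with x hx using (pi_v u x hx).deriv
  obtain ⟨F', hF, G', hG, h⟩ := FF_u u v hv
  have huu := (pi_u u v hv).fun_mul hF
  have hvv := ((pi_v u v hv).fun_mul hG).congr_of_eventuallyEq ev
  rw [eu]
  refine ⟨(pi_u u v hv).differentiableAt, huu.differentiableAt, (pi_v u v hv).differentiableAt,
    hvv.differentiableAt, ?_⟩
  rw [huu.deriv, hvv.deriv, (pi_v u v hv).deriv]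
  linear_combination (pi0 u v / 2) * h
end

section
/- For every fixed θ ∈ [0, π], as r → 0⁺ the stationary density satisfies π₀(r·cos θ, r·sin θ) ∼ √(2/(π·r)) · cos(θ/2 − π/4), i.e. the ratio π₀(r·cos θ, r·sin θ) / (√(2/(π·r)) · cos(θ/2 − π/4)) tends to 1 as r tends to 0 from the right. -/
open MeasureTheory

/-- For every fixed `θ ∈ [0, π]`, as `r → 0⁺`,
`π₀(r cos θ, r sin θ) ∼ √(2/(πr)) · cos(θ/2 − π/4)`: the ratio tends to `1`. -/
theorem pi0_asymptotics_at_origin (θ : ℝ) (hθ : θ ∈ Set.Icc 0 Real.pi) :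
    Filter.Tendsto
      (fun r : ℝ => pi0 (r * Real.cos θ) (r * Real.sin θ) /
        (Real.sqrt (2 / (Real.pi * r)) * Real.cos (θ / 2 - Real.pi / 4)))
      (nhdsWithin 0 (Set.Ioi 0)) (nhds 1) := by
  obtain ⟨h0, h1⟩ := hθ
  have hc : 0 < Real.cos (θ / 2 - Real.pi / 4) := by
    apply Real.cos_pos_of_mem_Ioo
    constructor <;> linarith [Real.pi_pos]
  have hs : 1 + Real.sin θ = 2 * Real.cos (θ / 2 - Real.pi / 4) ^ 2 := by
    have h := Real.cos_sq (θ / 2 - Real.pi / 4)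
    have h2 : 2 * (θ / 2 - Real.pi / 4) = θ - Real.pi / 2 := by ring
    rw [h2, Real.cos_sub_pi_div_two] at h
    rw [h]; ring
  have hlim : Filter.Tendsto (fun r : ℝ => Real.exp (-r - r * Real.sin θ))
      (nhdsWithin 0 (Set.Ioi 0)) (nhds 1) := by
    have hcont : Continuous (fun r : ℝ => Real.exp (-r - r * Real.sin θ)) := by fun_prop
    have h := hcont.tendsto 0
    simp only [neg_zero, zero_mul, sub_zero, Real.exp_zero] at h
    exact h.mono_left nhdsWithin_le_nhds
  refine hlim.congr' ?_
  filter_upwards [self_mem_nhdsWithin] with r hr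
  have hr : 0 < r := hr
  have e1 : Real.sqrt ((r * Real.cos θ) ^ 2 + (r * Real.sin θ) ^ 2) = r := by
    have : (r * Real.cos θ) ^ 2 + (r * Real.sin θ) ^ 2 = r ^ 2 := by
      linear_combination r ^ 2 * Real.sin_sq_add_cos_sq θ
    rw [this, Real.sqrt_sq hr.le]
  have e2 : Real.sqrt (r + r * Real.sin θ) =
      Real.sqrt 2 * Real.sqrt r * Real.cos (θ / 2 - Real.pi / 4) := by
    have : r + r * Real.sin θ = 2 * r * Real.cos (θ / 2 - Real.pi / 4) ^ 2 := by
      linear_combination r * hs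
    rw [this, Real.sqrt_mul (by positivity), Real.sqrt_sq hc.le, Real.sqrt_mul (by norm_num)]
  have e3 : Real.sqrt (2 / (Real.pi * r)) =
      Real.sqrt 2 / (Real.sqrt Real.pi * Real.sqrt r) := by
    rw [Real.sqrt_div (by norm_num), Real.sqrt_mul Real.pi_pos.le]
  have hpi : 0 < Real.sqrt Real.pi := Real.sqrt_pos.mpr Real.pi_pos
  have hsr : 0 < Real.sqrt r := Real.sqrt_pos.mpr hr
  have h2 : 0 < Real.sqrt 2 := by positivity
  have hrr : Real.sqrt r ^ 2 = r := Real.sq_sqrt hr.le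
  unfold pi0
  rw [e1, e2, e3]
  generalize Real.exp (-r - r * Real.sin θ) = E
  generalize Real.cos (θ / 2 - Real.pi / 4) = c at *
  generalize Real.sqrt Real.pi = p at *
  generalize Real.sqrt 2 = q at *
  generalize Real.sqrt r = t at *
  subst hrr
  field_simp
end

section
/- Assume μ₂ < 0 and r₊ < μ₁/μ₂. Set ρ := μ₁/μ₂, r₊⋆ := ρ − √(ρ² + 1), x₊ := √(μ₁² + μ₂²) − μ₁, and p := 2(r₊·μ₂ − μ₁)/(1 + r₊²). Then: (i) μ₂/r₊⋆ = x₊; (ii) 0 < p ≤ x₊, and p = x₊ if and only if r₊ = r₊⋆; (iii) r₊·p − μ₂ ≥ 0 if and only if r₊ ≥ r₊⋆, and when r₊ ≥ r₊⋆ one has r₊·p − μ₂ = √(μ₂² − 2μ₁·p − p²) (real square root), i.e. k₊(p, Y⁻(p)) = 0 where Y⁻(x) = −μ₂ − √(μ₂² − 2μ₁·x − x²) and k₊(x, y) = r₊·x + y. -/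
/-- Phase transition data for the tail asymptotics. Assume `μ₂ < 0` and
`r₊ < μ₁/μ₂`. With `ρ = μ₁/μ₂`, `r₊⋆ = ρ − √(ρ² + 1)`, `x₊ = √(μ₁² + μ₂²) − μ₁`
and `p = 2(r₊μ₂ − μ₁)/(1 + r₊²)`:
(i) `μ₂/r₊⋆ = x₊`;
(ii) `0 < p ≤ x₊`, with `p = x₊` iff `r₊ = r₊⋆`;
(iii) `r₊·p − μ₂ ≥ 0` iff `r₊ ≥ r₊⋆`, and when `r₊ ≥ r₊⋆` one has
`r₊·p − μ₂ = √(μ₂² − 2μ₁·p − p²)`, i.e. `k₊(p, Y⁻(p)) = 0`.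
Here `rp = r₊`, `rs = r₊⋆`, `xp = x₊`. -/
theorem phase_transition_pole_branch_point (μ₁ μ₂ rp : ℝ)
    (h₂ : μ₂ < 0) (hrec : rp < μ₁ / μ₂)
    (ρ rs xp p : ℝ)
    (hρ : ρ = μ₁ / μ₂)
    (hrs : rs = ρ - Real.sqrt (ρ ^ 2 + 1))
    (hxp : xp = Real.sqrt (μ₁ ^ 2 + μ₂ ^ 2) - μ₁)
    (hp : p = 2 * (rp * μ₂ - μ₁) / (1 + rp ^ 2)) :
    μ₂ / rs = xp ∧
    (0 < p ∧ p ≤ xp ∧ (p = xp ↔ rp = rs)) ∧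
    ((0 ≤ rp * p - μ₂ ↔ rs ≤ rp) ∧
      (rs ≤ rp → rp * p - μ₂ = Real.sqrt (μ₂ ^ 2 - 2 * μ₁ * p - p ^ 2))) := by
  have hμ : μ₁ = ρ * μ₂ := by rw [hρ, div_mul_cancel₀ _ h₂.ne]
  rw [← hρ] at hrec
  clear hρ
  subst hμ
  obtain ⟨s, hs⟩ : ∃ s, s = Real.sqrt (ρ ^ 2 + 1) := ⟨_, rfl⟩
  have hs2 : s ^ 2 = ρ ^ 2 + 1 := by rw [hs]; exact Real.sq_sqrt (by positivity)
  have hs0 : 0 ≤ s := by rw [hs]; exact Real.sqrt_nonneg _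
  have hsq : Real.sqrt ((ρ * μ₂) ^ 2 + μ₂ ^ 2) = -μ₂ * s := by
    rw [show (ρ * μ₂) ^ 2 + μ₂ ^ 2 = (-μ₂ * s) ^ 2 by linear_combination (-μ₂ ^ 2) * hs2]
    exact Real.sqrt_sq (mul_nonneg (by linarith) hs0)
  rw [← hs] at hrs
  rw [hsq] at hxp
  have hlt : |ρ| < s := abs_lt_of_sq_lt_sq (by linarith) hs0
  obtain ⟨ha, hb⟩ := abs_lt.mp hlt
  have hd : 0 < 1 + rp ^ 2 := by positivity
  have hrs0 : rs < 0 := by linarith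
  have hxp' : xp = -μ₂ * (s + ρ) := by rw [hxp]; ring
  have hxp0 : 0 < xp := by rw [hxp']; exact mul_pos (by linarith) (by linarith)
  have hpd : p * (1 + rp ^ 2) = 2 * (rp * μ₂ - ρ * μ₂) := by rw [hp]; field_simp
  have hgap : (xp - p) * (1 + rp ^ 2) = xp * (rp - rs) ^ 2 := by
    rw [sub_mul, hpd, hxp', hrs]
    linear_combination (-μ₂) * (-2 * rp - (s - ρ)) * hs2
  have hk : (rp * p - μ₂) * (1 + rp ^ 2) = (-μ₂ * (ρ + s - rp)) * (rp - rs) := by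
    rw [hrs]
    linear_combination rp * hpd + μ₂ * hs2
  have hc : 0 < -μ₂ * (ρ + s - rp) := mul_pos (by linarith) (by linarith)
  have hiff : 0 ≤ rp * p - μ₂ ↔ rs ≤ rp := by
    rw [← mul_nonneg_iff_of_pos_right hd, hk, mul_nonneg_iff_of_pos_left hc, sub_nonneg]
  refine ⟨?_, ⟨?_, ?_, ?_, ?_⟩, hiff, ?_⟩
  · rw [div_eq_iff hrs0.ne, hxp', hrs]
    linear_combination (-μ₂) * hs2
  · rw [hp]
    exact div_pos (by nlinarith) hd
  · have : 0 ≤ (xp - p) * (1 + rp ^ 2) := by rw [hgap]; positivity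
    linarith [(mul_nonneg_iff_of_pos_right hd).mp this]
  · intro h
    rw [h, sub_self, zero_mul] at hgap
    have := (mul_eq_zero.mp hgap.symm).resolve_left hxp0.ne'
    linarith [pow_eq_zero_iff (two_ne_zero) |>.mp this]
  · intro h
    have h0 : (xp - p) * (1 + rp ^ 2) = 0 := by rw [hgap, h]; ring
    linarith [(mul_eq_zero.mp h0).resolve_right hd.ne']
  · intro h
    rw [show μ₂ ^ 2 - 2 * (ρ * μ₂) * p - p ^ 2 = (rp * p - μ₂) ^ 2 by
      linear_combination (-p) * hpd]
    exact (Real.sqrt_sq (hiff.mpr h)).symm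
end
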